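/- arXiv:2310.15963 — 2 statements merged into one kernel-verified Lean document; each statement's English description precedes it below -/
import Mathlib

section
/- Decay of oscillatory integrals with singular amplitudes (analytic core of Proposition 2.14). Let n > −1 be a real number and let L be a positive integer with L > n + 1. Let η : ℝ → ℝ be a C^∞ function whose support is contained in [−3π/2, 3π/2]. Then there exists C > 0, depending only on n, L and η, such that for every M > 0 and every function ρ : ℝ∖{0} → ℂ that is L-times continuously differentiable on ℝ∖{0} and satisfies |ρ^{(l)}(z)| ≤ M·|z|^{n−l} for all z with 0 < |z| ≤ 3π/2 and all l = 0, 1, …, L, the function z ↦ ρ(z)·η(z) is Lebesgue integrable on ℝ and for every ξ ∈ ℝ one has | ∫_ℝ ρ(z)·η(z)·e^{−iξz} dz | ≤ C·M·(1 + |ξ|)^{−(1+n)}. -/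
open Real MeasureTheory

/-- One integration by parts against `e^{-iξz}` for an amplitude vanishing at the right endpoint. -/
lemma norm_integral_mul_exp_le_of_hasDerivAt {u u' : ℝ → ℂ} {δ b ξ : ℝ} (hδb : δ ≤ b)
    (hξ : ξ ≠ 0) (hu : ∀ z ∈ Set.Icc δ b, HasDerivAt u (u' z) z)
    (hu' : ContinuousOn u' (Set.Icc δ b)) (hub : u b = 0) :
    ‖∫ z in δ..b, u z * Complex.exp (-Complex.I * ξ * z)‖
      ≤ |ξ|⁻¹ * (‖u δ‖ + ‖∫ z in δ..b, u' z * Complex.exp (-Complex.I * ξ * z)‖) := by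
  have hc : (-Complex.I * ξ : ℂ) ≠ 0 := by simp [hξ]
  have hv : ∀ z : ℝ, HasDerivAt
      (fun z : ℝ => (-Complex.I * ξ : ℂ)⁻¹ * Complex.exp (-Complex.I * ξ * z))
      (Complex.exp (-Complex.I * ξ * z)) z := by
    intro z
    have h1 : HasDerivAt (fun z : ℝ => (-Complex.I * ξ * z : ℂ)) (-Complex.I * ξ) z := by
      simpa using (Complex.ofRealCLM.hasDerivAt (x := z)).const_mul (-Complex.I * ξ : ℂ)
    have h2 := h1.cexp.const_mul (-Complex.I * ξ : ℂ)⁻¹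
    rwa [mul_comm (Complex.exp _) (-Complex.I * ξ : ℂ), inv_mul_cancel_left₀ hc] at h2
  have key := intervalIntegral.integral_mul_deriv_eq_deriv_mul (a := δ) (b := b)
    (u := u) (u' := u') (by rwa [Set.uIcc_of_le hδb]) (fun z _ => hv z)
    ((by rwa [Set.uIcc_of_le hδb] : ContinuousOn u' (Set.uIcc δ b)).intervalIntegrable)
    ((by fun_prop : Continuous fun z : ℝ => Complex.exp (-Complex.I * ξ * z)).intervalIntegrable
      _ _)
  have hn : ‖(-Complex.I * ξ : ℂ)⁻¹‖ = |ξ|⁻¹ := by simp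
  have hE : ∀ z : ℝ, ‖Complex.exp (-Complex.I * ξ * z)‖ = 1 := fun z => by
    simp [Complex.norm_exp]
  have hr : ∫ z in δ..b, u' z * ((-Complex.I * ξ : ℂ)⁻¹ * Complex.exp (-Complex.I * ξ * z))
      = (-Complex.I * ξ : ℂ)⁻¹ * ∫ z in δ..b, u' z * Complex.exp (-Complex.I * ξ * z) := by
    rw [← intervalIntegral.integral_const_mul]
    congr 1
    ext z
    ring
  rw [key, hub, hr, zero_mul, zero_sub]
  refine (norm_sub_le _ _).trans (le_of_eq ?_)
  rw [norm_neg, norm_mul, norm_mul, norm_mul, hn, hE]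
  ring

/-- Repeated integration by parts away from the singularity, at the scale `|ξ|⁻¹`. -/
lemma norm_integral_mul_exp_le_of_iterate (L : ℕ) {b ξ K : ℝ} (hξ : ξ ≠ 0) (hb : |ξ|⁻¹ ≤ b)
    (hK : 0 ≤ K) : ∀ (n : ℝ) (g : ℕ → ℝ → ℂ), n + 1 < L →
    (∀ k < L, ∀ z > 0, HasDerivAt (g k) (g (k + 1) z) z) →
    (∀ k ≤ L, ContinuousOn (g k) (Set.Ioi 0)) → (∀ k < L, g k b = 0) →
    (∀ k ≤ L, ∀ z > 0, z ≤ b → ‖g k z‖ ≤ K * z ^ (n - k)) →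
    ‖∫ z in |ξ|⁻¹..b, g 0 z * Complex.exp (-Complex.I * ξ * z)‖
      ≤ K * (L + (L - (n + 1))⁻¹) * |ξ|⁻¹ ^ (n + 1) := by
  have hδ : 0 < |ξ|⁻¹ := by positivity
  set δ := |ξ|⁻¹
  induction L with
  | zero =>
    intro n g hn _ _ _ hg
    have hn' : n + 1 < 0 := by simpa using hn
    have h0 : (0 : ℝ) ∉ Set.uIcc δ b := by
      rw [Set.uIcc_of_le hb]
      exact fun h => absurd h.1 (not_le.2 hδ)
    have h1 : ‖∫ z in δ..b, g 0 z * Complex.exp (-Complex.I * ξ * z)‖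
        ≤ ∫ z in δ..b, K * z ^ n := by
      refine intervalIntegral.norm_integral_le_of_norm_le hb (Filter.Eventually.of_forall ?_)
        ((intervalIntegral.intervalIntegrable_rpow (Or.inr h0)).const_mul K)
      intro z hz
      simpa [Complex.norm_exp] using hg 0 le_rfl z (hδ.trans hz.1) hz.2
    refine h1.trans ?_
    rw [intervalIntegral.integral_const_mul,
      integral_rpow (Or.inr ⟨by linarith, h0⟩), mul_assoc]
    refine mul_le_mul_of_nonneg_left ?_ hK
    have hbn : 0 ≤ b ^ (n + 1) := rpow_nonneg (hδ.le.trans hb) _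
    rw [Nat.cast_zero, zero_add, zero_sub, ← neg_div_neg_eq, div_eq_inv_mul]
    refine mul_le_mul_of_nonneg_left (by linarith) (inv_nonneg.2 (by linarith))
  | succ L ih =>
    intro n g hn hd hc hgb hg
    push_cast at hn
    have h1 := norm_integral_mul_exp_le_of_hasDerivAt hb hξ (u := g 0) (u' := g 1)
      (fun z hz => hd 0 (by omega) z (hδ.trans_le hz.1))
      ((hc 1 (by omega)).mono fun z hz => hδ.trans_le hz.1) (hgb 0 (by omega))
    have h2 := ih (n - 1) (fun k => g (k + 1)) (by linarith)
      (fun k hk => hd (k + 1) (by omega)) (fun k hk => hc (k + 1) (by omega))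
      (fun k hk => hgb (k + 1) (by omega)) (fun k hk z hz hzb => by
        have := hg (k + 1) (by omega) z hz hzb
        rwa [show n - ((k + 1 : ℕ) : ℝ) = n - 1 - k by push_cast; ring] at this)
    have h3 := hg 0 (by omega) δ hδ hb
    rw [Nat.cast_zero, sub_zero] at h3
    rw [sub_add_cancel] at h2
    refine h1.trans ((mul_le_mul_of_nonneg_left (add_le_add h3 h2) hδ.le).trans (le_of_eq ?_))
    rw [rpow_add_one hδ.ne', show ((L + 1 : ℕ) : ℝ) - (n + 1) = L - n by push_cast; ring]
    push_cast
    ring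

/-- Integrability and decay of the oscillatory integral on one side of the singularity. -/
lemma half_line_oscillatory_integral_decay {n b : ℝ} (hn : -1 < n) {L : ℕ}
    (hLn : n + 1 < (L : ℝ)) (hb : 1 ≤ b) :
    ∃ C > (0 : ℝ), ∀ K ≥ (0 : ℝ), ∀ f : ℝ → ℂ, ContDiffOn ℝ L f (Set.Ioi 0) →
      (∀ l ≤ L, ∀ z > 0, z ≤ b → ‖iteratedDeriv l f z‖ ≤ K * z ^ (n - l)) →
      (∀ l ≤ L, iteratedDeriv l f b = 0) →
      IntervalIntegrable f volume 0 b ∧ ∀ ξ : ℝ,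
        ‖∫ z in (0 : ℝ)..b, f z * Complex.exp (-Complex.I * ξ * z)‖
          ≤ C * K * (1 + |ξ|) ^ (-(1 + n)) := by
  have hb0 : 0 < b := by linarith
  have hn1 : 0 < n + 1 := by linarith
  have hL : 0 < (L : ℝ) - (n + 1) := by linarith
  set c : ℝ := (n + 1)⁻¹ + (L + ((L : ℝ) - (n + 1))⁻¹) with hc
  have hc0 : 0 < c := by positivity
  refine ⟨2 ^ (n + 1) * (c + b ^ (n + 1) * (n + 1)⁻¹), by positivity, ?_⟩
  intro K hK f hf hbd hfb
  have hcont : ∀ k ≤ L, ContinuousOn (iteratedDeriv k f) (Set.Ioi 0) := fun k hk =>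
    (hf.continuousOn_iteratedDerivWithin (by exact_mod_cast hk)
      (uniqueDiffOn_Ioi 0)).congr fun z hz => (iteratedDerivWithin_of_isOpen isOpen_Ioi hz).symm
  have hderiv : ∀ k < L, ∀ z > 0,
      HasDerivAt (iteratedDeriv k f) (iteratedDeriv (k + 1) f z) z := by
    intro k hk z hz
    rw [iteratedDeriv_succ]
    refine DifferentiableAt.hasDerivAt ?_
    have h1 := (hf.differentiableOn_iteratedDerivWithin (m := k) (by exact_mod_cast hk)
      (uniqueDiffOn_Ioi 0)).congr fun z hz => (iteratedDerivWithin_of_isOpen isOpen_Ioi hz).symm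
    exact h1.differentiableAt (Ioi_mem_nhds hz)
  have hbd0 : ∀ z > 0, z ≤ b → ‖f z‖ ≤ K * z ^ n := fun z hz hzb => by
    simpa using hbd 0 (Nat.zero_le _) z hz hzb
  have hpow : ∀ x y : ℝ, IntervalIntegrable (fun z : ℝ => K * z ^ n) volume x y := fun x y =>
    (intervalIntegral.intervalIntegrable_rpow' hn).const_mul K
  have hint : IntervalIntegrable f volume 0 b := by
    refine (hpow 0 b).mono_fun' ?_ ?_
    · rw [Set.uIoc_of_le hb0.le]
      exact ((by simpa using hcont 0 (Nat.zero_le _) : ContinuousOn f (Set.Ioi 0)).mono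
        fun z hz => hz.1).aestronglyMeasurable measurableSet_Ioc
    · rw [Set.uIoc_of_le hb0.le]
      exact (ae_restrict_iff' measurableSet_Ioc).2
        (Filter.Eventually.of_forall fun z hz => hbd0 z hz.1 hz.2)
  refine ⟨hint, fun ξ => ?_⟩
  have hnear : ∀ x, 0 ≤ x → x ≤ b →
      ‖∫ z in (0 : ℝ)..x, f z * Complex.exp (-Complex.I * ξ * z)‖
        ≤ K * (x ^ (n + 1) * (n + 1)⁻¹) := by
    intro x hx hxb
    have h1 : ‖∫ z in (0 : ℝ)..x, f z * Complex.exp (-Complex.I * ξ * z)‖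
        ≤ ∫ z in (0 : ℝ)..x, K * z ^ n := by
      refine intervalIntegral.norm_integral_le_of_norm_le hx (Filter.Eventually.of_forall ?_)
        (hpow _ _)
      intro z hz
      simpa [Complex.norm_exp] using hbd0 z hz.1 (hz.2.trans hxb)
    rwa [intervalIntegral.integral_const_mul, integral_rpow (Or.inl hn),
      zero_rpow hn1.ne', sub_zero, div_eq_mul_inv] at h1
  have hneg : (1 + |ξ|) ^ (-(1 + n)) = ((1 + |ξ|) ^ (n + 1))⁻¹ := by
    rw [rpow_neg (by positivity), add_comm 1 n]
  have h1ξ : 0 < (1 + |ξ|) ^ (n + 1) := by positivity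
  rw [hneg]
  rcases lt_or_ge |ξ| 1 with hξ | hξ
  · refine (hnear b hb0.le le_rfl).trans ?_
    rw [← div_eq_mul_inv _ ((1 + |ξ|) ^ (n + 1)), le_div_iff₀ h1ξ]
    have h2 : (1 + |ξ|) ^ (n + 1) ≤ 2 ^ (n + 1) :=
      rpow_le_rpow (by positivity) (by linarith) hn1.le
    calc K * (b ^ (n + 1) * (n + 1)⁻¹) * (1 + |ξ|) ^ (n + 1)
        ≤ K * (b ^ (n + 1) * (n + 1)⁻¹) * 2 ^ (n + 1) := by gcongr
      _ ≤ K * (c + b ^ (n + 1) * (n + 1)⁻¹) * 2 ^ (n + 1) := by gcongr; linarith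
      _ = _ := by ring
  · have hξ0 : ξ ≠ 0 := by
      rintro rfl
      norm_num at hξ
    have hδ0 : 0 < |ξ|⁻¹ := by positivity
    have hδb : |ξ|⁻¹ ≤ b := (inv_le_one_of_one_le₀ hξ).trans hb
    have hfar := norm_integral_mul_exp_le_of_iterate L hξ0 hδb hK n
      (fun k => iteratedDeriv k f) hLn hderiv hcont (fun k hk => hfb k hk.le) hbd
    simp only [iteratedDeriv_zero] at hfar
    have hprod : IntervalIntegrable (fun z : ℝ => f z * Complex.exp (-Complex.I * ξ * z))
        volume 0 b :=
      hint.mul_continuousOn (by fun_prop)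
    have hsplit := intervalIntegral.integral_add_adjacent_intervals
      (hprod.mono_set (c := 0) (d := |ξ|⁻¹) (by
        rw [Set.uIcc_of_le hb0.le, Set.uIcc_of_le hδ0.le]
        exact Set.Icc_subset_Icc_right hδb))
      (hprod.mono_set (c := |ξ|⁻¹) (d := b) (by
        rw [Set.uIcc_of_le hb0.le, Set.uIcc_of_le hδb]
        exact Set.Icc_subset_Icc_left hδ0.le))
    have h4 : |ξ|⁻¹ ^ (n + 1) ≤ 2 ^ (n + 1) * ((1 + |ξ|) ^ (n + 1))⁻¹ := by
      rw [← inv_rpow (by positivity), ← mul_rpow (by positivity) (by positivity)]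
      refine rpow_le_rpow hδ0.le ?_ hn1.le
      rw [← div_eq_mul_inv, inv_eq_one_div, div_le_div_iff₀ (by positivity) (by positivity)]
      linarith
    rw [← hsplit]
    calc _ ≤ K * (|ξ|⁻¹ ^ (n + 1) * (n + 1)⁻¹)
          + K * (L + (L - (n + 1))⁻¹) * |ξ|⁻¹ ^ (n + 1) :=
          (norm_add_le _ _).trans (add_le_add (hnear _ hδ0.le hδb) hfar)
      _ = K * c * |ξ|⁻¹ ^ (n + 1) := by rw [hc]; ring
      _ ≤ K * (c + b ^ (n + 1) * (n + 1)⁻¹) * (2 ^ (n + 1) * ((1 + |ξ|) ^ (n + 1))⁻¹) := by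
          gcongr
          have : 0 ≤ b ^ (n + 1) * (n + 1)⁻¹ := by positivity
          linarith
      _ = _ := by ring

/-- Leibniz bound: multiplication by a smooth function preserves symbol-type bounds. -/
lemma exists_norm_iteratedDeriv_mul_le (n a : ℝ) (ha : 1 ≤ a) (L : ℕ) {η : ℝ → ℝ}
    (hη : ContDiff ℝ (⊤ : ℕ∞) η) :
    ∃ D > (0 : ℝ), ∀ M > (0 : ℝ), ∀ ρ : ℝ → ℂ, ContDiffOn ℝ L ρ {(0 : ℝ)}ᶜ →
      (∀ l ≤ L, ∀ z : ℝ, z ≠ 0 → |z| ≤ a → ‖iteratedDeriv l ρ z‖ ≤ M * |z| ^ (n - l)) →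
      ∀ l ≤ L, ∀ z : ℝ, z ≠ 0 → |z| ≤ a →
        ‖iteratedDeriv l (fun z => ρ z * (η z : ℂ)) z‖ ≤ M * D * |z| ^ (n - l) := by
  have hη' : ContDiff ℝ (⊤ : ℕ∞) (fun z => (η z : ℂ)) :=
    Complex.ofRealCLM.contDiff.comp hη
  have hB : ∀ j : ℕ, ∃ B : ℝ, ∀ z ∈ Set.Icc (-a) a,
      ‖iteratedDeriv j (fun z => (η z : ℂ)) z‖ ≤ B := fun j =>
    isCompact_Icc.exists_bound_of_continuousOn
      (hη'.continuous_iteratedDeriv j (by exact_mod_cast le_top)).continuousOn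
  choose B hB using hB
  have hB0 : ∀ j, 0 ≤ B j := fun j =>
    (norm_nonneg _).trans (hB j 0 ⟨by linarith, by linarith⟩)
  set S : ℝ := ∑ j ∈ Finset.range (L + 1), B j with hS
  have hBS : ∀ j ≤ L, B j ≤ S := fun j hj =>
    Finset.single_le_sum (fun i _ => hB0 i) (Finset.mem_range.2 (by omega))
  have hS0 : 0 ≤ S := Finset.sum_nonneg fun j _ => hB0 j
  refine ⟨2 ^ L * a ^ L * (S + 1), by positivity, ?_⟩
  intro M hM ρ hρ hbd l hl z hz hza
  have hz0 : 0 < |z| := abs_pos.2 hz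
  have hρz : ContDiffAt ℝ l ρ z :=
    ((hρ.contDiffAt (isOpen_compl_singleton.mem_nhds hz)).of_le (by exact_mod_cast hl))
  rw [iteratedDeriv_fun_mul hρz (hη'.contDiffAt.of_le (by exact_mod_cast le_top))]
  have hterm : ∀ i ∈ Finset.range (l + 1),
      ‖(l.choose i : ℂ) * iteratedDeriv i ρ z * iteratedDeriv (l - i) (fun z => (η z : ℂ)) z‖
        ≤ l.choose i * (M * |z| ^ (n - l) * a ^ L * (S + 1)) := by
    intro i hi
    have hil : i ≤ l := by simpa [Nat.lt_succ_iff] using hi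
    have h1 := hbd i (hil.trans hl) z hz hza
    have h2 : ‖iteratedDeriv (l - i) (fun z => (η z : ℂ)) z‖ ≤ S + 1 :=
      (hB (l - i) z (abs_le.1 hza)).trans ((hBS _ (by omega)).trans (by linarith))
    have h3 : |z| ^ (n - i) ≤ |z| ^ (n - l) * a ^ L := by
      have : n - i = n - l + ((l - i : ℕ) : ℝ) := by
        rw [Nat.cast_sub hil]
        ring
      rw [this, rpow_add hz0, rpow_natCast]
      gcongr
      exact (pow_le_pow_left₀ hz0.le hza _).trans (pow_le_pow_right₀ ha (by omega))
    rw [norm_mul, norm_mul, Complex.norm_natCast, mul_assoc]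
    refine mul_le_mul_of_nonneg_left ?_ (Nat.cast_nonneg _)
    calc ‖iteratedDeriv i ρ z‖ * ‖iteratedDeriv (l - i) (fun z => (η z : ℂ)) z‖
        ≤ (M * |z| ^ (n - i)) * (S + 1) := by gcongr
      _ ≤ (M * (|z| ^ (n - l) * a ^ L)) * (S + 1) := by gcongr
      _ = _ := by ring
  refine (norm_sum_le_of_le _ hterm).trans ?_
  rw [← Finset.sum_mul, ← Nat.cast_sum, Nat.sum_range_choose]
  push_cast
  calc (2 : ℝ) ^ l * (M * |z| ^ (n - l) * a ^ L * (S + 1))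
      ≤ 2 ^ L * (M * |z| ^ (n - l) * a ^ L * (S + 1)) := by
        gcongr
        norm_num
    _ = _ := by ring

/-- Decay of oscillatory integrals with singular amplitudes (analytic core of
Proposition 2.14). Let `n > −1`, let `L` be a positive integer with `L > n + 1`, and let
`η` be a smooth real function supported in `[−3π/2, 3π/2]`. Then there exists `C > 0`
such that for every `M > 0` and every `ρ : ℝ → ℂ` which is `L`-times continuously
differentiable off `0` with `|ρ^{(l)}(z)| ≤ M·|z|^{n−l}` for `0 < |z| ≤ 3π/2` and
`l = 0,…,L`, the function `z ↦ ρ(z)·η(z)` is integrable and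
`|∫ ρ(z)η(z)e^{−iξz} dz| ≤ C·M·(1+|ξ|)^{−(1+n)}` for all `ξ`. -/
theorem oscillatory_integral_decay (n : ℝ) (hn : -1 < n) (L : ℕ) (hL : 1 ≤ L)
    (hLn : n + 1 < (L : ℝ)) (η : ℝ → ℝ) (hη : ContDiff ℝ (⊤ : ℕ∞) η)
    (hsupp : Function.support η ⊆ Set.Icc (-(3 * π / 2)) (3 * π / 2)) :
    ∃ C > (0 : ℝ), ∀ M > (0 : ℝ), ∀ ρ : ℝ → ℂ,
      ContDiffOn ℝ L ρ {(0 : ℝ)}ᶜ →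
      (∀ l ≤ L, ∀ z : ℝ, z ≠ 0 → |z| ≤ 3 * π / 2 →
        ‖iteratedDeriv l ρ z‖ ≤ M * |z| ^ (n - l)) →
      Integrable (fun z : ℝ => ρ z * (η z : ℂ)) ∧
      ∀ ξ : ℝ,
        ‖∫ z : ℝ, ρ z * (η z : ℂ) * Complex.exp (-Complex.I * ξ * z)‖
          ≤ C * M * (1 + |ξ|) ^ (-(1 + n)) := by
  set a : ℝ := 3 * π / 2 with ha
  have ha1 : 1 ≤ a := by
    have := pi_gt_three
    rw [ha]
    linarith
  obtain ⟨D, hD, hDbd⟩ := exists_norm_iteratedDeriv_mul_le n a ha1 L hη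
  obtain ⟨C, hC, hCbd⟩ := half_line_oscillatory_integral_decay (b := a + 1) hn hLn (by linarith)
  refine ⟨2 * C * D, by positivity, ?_⟩
  intro M hM ρ hρ hbd
  set f : ℝ → ℂ := fun z => ρ z * (η z : ℂ) with hf
  have hf0 : ∀ z, a < |z| → f z = 0 := by
    intro z hz
    have : η z = 0 := by
      by_contra h
      exact absurd (abs_le.2 (hsupp h)) (not_le.2 hz)
    simp [hf, this]
  have hd0 : ∀ l, ∀ z, a < |z| → iteratedDeriv l f z = 0 := by
    intro l z hz
    have h1 : f =ᶠ[nhds z] fun _ => 0 := by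
      filter_upwards [(isOpen_lt continuous_const continuous_abs).mem_nhds hz] with w hw
      exact hf0 w hw
    rw [h1.iteratedDeriv_eq l]
    simp
  have hfbd : ∀ l ≤ L, ∀ z : ℝ, z ≠ 0 → ‖iteratedDeriv l f z‖ ≤ M * D * |z| ^ (n - l) := by
    intro l hl z hz
    rcases le_or_gt |z| a with h | h
    · exact hDbd M hM ρ hρ hbd l hl z hz h
    · rw [hd0 l z h, norm_zero]
      positivity
  have hfc : ContDiffOn ℝ L f {(0 : ℝ)}ᶜ :=
    hρ.mul ((Complex.ofRealCLM.contDiff.comp hη).of_le (by exact_mod_cast le_top)).contDiffOn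
  have hb : a < |a + 1| := (lt_add_one a).trans_le (le_abs_self _)
  obtain ⟨hI₁, hE₁⟩ := hCbd (M * D) (by positivity) f
    (hfc.mono fun z (hz : 0 < z) => hz.ne')
    (fun l hl z hz _ => by simpa [abs_of_pos hz] using hfbd l hl z hz.ne')
    (fun l _ => hd0 l _ hb)
  obtain ⟨hI₂, hE₂⟩ := hCbd (M * D) (by positivity) (fun z => f (-z))
    (hfc.comp contDiff_neg.contDiffOn fun z (hz : 0 < z) => (neg_ne_zero.2 hz.ne'))
    (fun l hl z hz _ => by
      rw [iteratedDeriv_comp_neg, norm_smul]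
      simpa [abs_of_pos hz] using hfbd l hl (-z) (neg_ne_zero.2 hz.ne'))
    (fun l _ => by rw [iteratedDeriv_comp_neg, hd0 l _ (by rwa [abs_neg]), smul_zero])
  have hI₃ : IntervalIntegrable f volume (-(a + 1)) 0 := by
    simpa using ((IntervalIntegrable.iff_comp_neg).1 hI₂).symm
  have hle : -(a + 1) ≤ a + 1 := by linarith
  have hout : ∀ z, z ∉ Set.Ioc (-(a + 1)) (a + 1) → f z = 0 := by
    intro z hz
    refine hf0 z (lt_of_not_ge fun h => hz ?_)
    have := abs_le.1 h
    exact ⟨by linarith, by linarith⟩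
  refine ⟨?_, fun ξ => ?_⟩
  · rw [← integrableOn_iff_integrable_of_support_subset (s := Set.Ioc (-(a + 1)) (a + 1))
      (fun z hz => by_contra fun h => hz (hout z h))]
    exact (intervalIntegrable_iff_integrableOn_Ioc_of_le hle).1 (hI₃.trans hI₁)
  · have h1 : ∫ z : ℝ, f z * Complex.exp (-Complex.I * ξ * z)
        = ∫ z in (-(a + 1))..(a + 1), f z * Complex.exp (-Complex.I * ξ * z) := by
      rw [intervalIntegral.integral_of_le hle]
      exact (setIntegral_eq_integral_of_forall_compl_eq_zero
        fun z hz => by rw [hout z hz, zero_mul]).symm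
    have h2 : ∫ z in (-(a + 1))..0, f z * Complex.exp (-Complex.I * ξ * z)
        = ∫ z in (0 : ℝ)..(a + 1), f (-z) * Complex.exp (-Complex.I * (-ξ : ℝ) * z) := by
      rw [← neg_zero, ← intervalIntegral.integral_comp_neg, neg_zero]
      simp
    have h3 := hE₂ (-ξ)
    rw [abs_neg, ← h2] at h3
    rw [h1, ← intervalIntegral.integral_add_adjacent_intervals
      (hI₃.mul_continuousOn (by fun_prop)) (hI₁.mul_continuousOn (by fun_prop))]
    calc _ ≤ C * (M * D) * (1 + |ξ|) ^ (-(1 + n)) + C * (M * D) * (1 + |ξ|) ^ (-(1 + n)) :=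
          (norm_add_le _ _).trans (add_le_add h3 (hE₁ ξ))
      _ = _ := by ring
end

section
/- Hamiltonian cancellation identity (equation (5.42), verified in Appendix A). Fix α ∈ (0,2) and let f : ℝ → ℝ be C^∞ and 2π-periodic with 1 + 2f(x) > 0 for all x. Assume that for all x ∈ ℝ and all z with 0 < |z| < π, writing X := X_f(x,z), one has 1 − 4X·sin(z/2) > 0 and 1 − 2X·sin(z/2) − √(1 − 4X·sin(z/2))·cos z > 0, and assume there exist C^∞ functions Φ₁, Φ₂, Φ₃ : ℝ × (−π, π) → ℝ such that Φ_j(x,z) = K^j_{α,z}(X_f(x,z)) for all x ∈ ℝ and all 0 < |z| < π (j = 1,2,3). Define K^{j,l}(x) := (1/l!)·∂_z^l Φ_j(x,0) for l = 0, 1, and set A₀(x) := (1+2f(x))^{−α/2}·[ K^{1,0}(x) + (α−1)·K^{2,0}(x) + (f'(x)/(1+2f(x)))·K^{3,0}(x) ] + (2−α) and A₁(x) := (1+2f(x))^{−α/2}·[ K^{1,1}(x) + (α−2)·K^{2,1}(x) + (1/(1+2f(x)))·( f'(x)·K^{3,1}(x) − f''(x)·K^{3,0}(x) ) ]. Then A₁(x)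 + (1/2)·A₀'(x) = 0 for every x ∈ ℝ. -/
open Real

/-- `S(X,z) := 1 − 4X·sin(z/2)` (the quantity under the square root). -/
noncomputable def Sq (X z : ℝ) : ℝ := 1 - 4 * X * Real.sin (z / 2)

/-- `D(X,z) := 1 − 2X·sin(z/2) − √(1 − 4X·sin(z/2))·cos z`. -/
noncomputable def Dz (X z : ℝ) : ℝ :=
  1 - 2 * X * Real.sin (z / 2) - Real.sqrt (Sq X z) * Real.cos z

/-- The kernel `K¹_{α,z}(X)`. -/
noncomputable def K1 (α X z : ℝ) : ℝ :=
  (-((2 - Real.cos z / Real.sqrt (Sq X z)) / (2 * Dz X z) ^ (α / 2))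
      + α * ((1 - Real.cos z / Real.sqrt (Sq X z)) *
          (Sq X z - Real.sqrt (Sq X z) * Real.cos z)) / (2 * Dz X z) ^ (α / 2 + 1))
    * |2 * Real.sin (z / 2)| ^ α

/-- The kernel `K²_{α,z}(X)`. -/
noncomputable def K2 (α X z : ℝ) : ℝ :=
  |2 * Real.sin (z / 2)| ^ α / (Real.sqrt (Sq X z) * (2 * Dz X z) ^ (α / 2))

/-- The kernel `K³_{α,z}(X)`. -/
noncomputable def K3 (α X z : ℝ) : ℝ :=
  ((Sq X z) ^ (-(3 / 2) : ℝ) / (2 * Dz X z) ^ (α / 2)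
      + α * (1 - Real.cos z / Real.sqrt (Sq X z)) * (Sq X z) ^ (-(1 / 2) : ℝ) /
          (2 * Dz X z) ^ (α / 2 + 1))
    * |2 * Real.sin (z / 2)| ^ α * Real.sin z

/-- The periodic finite difference `Δ_z f(x) := (f(x) − f(x−z))/(2 sin(z/2))`. -/
noncomputable def deltaZ (f : ℝ → ℝ) (x z : ℝ) : ℝ :=
  (f x - f (x - z)) / (2 * Real.sin (z / 2))

/-- `X_f(x,z) := Δ_z f(x)/(1 + 2f(x))`. -/
noncomputable def Xf (f : ℝ → ℝ) (x z : ℝ) : ℝ := deltaZ f x z / (1 + 2 * f x)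

open Filter Topology in
/-- A twice differentiable function vanishing at `0` factors as `z * g z`, with `g` differentiable
at `0`. -/
lemma exists_eq_id_mul_hasDerivAt {h h' : ℝ → ℝ} {d : ℝ} (hd : ∀ z, HasDerivAt h (h' z) z)
    (hd' : HasDerivAt h' d 0) (h0 : h 0 = 0) :
    ∃ g : ℝ → ℝ, (∀ z, h z = z * g z) ∧ g 0 = h' 0 ∧ HasDerivAt g (d / 2) 0 := by
  classical
  refine ⟨fun z => if z = 0 then h' 0 else h z / z, fun z => ?_, by simp, ?_⟩
  · by_cases hz : z = 0
    · simp [hz, h0]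
    · simp only [hz, if_false]
      field_simp
  · rw [hasDerivAt_iff_tendsto_slope]
    have key : Tendsto (fun z => (h z - h' 0 * z) / z ^ 2) (𝓝[≠] 0) (𝓝 (d / 2)) := by
      refine HasDerivAt.lhopital_zero_nhdsNE (f' := fun z => h' z - h' 0)
        (g' := fun z => 2 * z) ?_ ?_ ?_ ?_ ?_ ?_
      · exact Eventually.of_forall fun z => by
          simpa using! (hd z).sub ((hasDerivAt_id z).const_mul (h' 0))
      · exact Eventually.of_forall fun z => by simpa using hasDerivAt_pow 2 z
      · filter_upwards [self_mem_nhdsWithin] with z hz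
        exact mul_ne_zero two_ne_zero hz
      · have : ContinuousAt (fun z => h z - h' 0 * z) 0 :=
          (hd 0).continuousAt.sub (by fun_prop)
        simpa [ContinuousAt, h0] using this.tendsto.mono_left nhdsWithin_le_nhds
      · have : ContinuousAt (fun z : ℝ => z ^ 2) 0 := by fun_prop
        simpa [ContinuousAt] using this.tendsto.mono_left nhdsWithin_le_nhds
      · have := (hasDerivAt_iff_tendsto_slope.1 hd').div_const 2
        refine this.congr' ?_
        filter_upwards [self_mem_nhdsWithin] with z hz
        have hz : z ≠ 0 := hz
        simp only [slope_def_field, sub_zero]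
        field_simp
    refine key.congr' ?_
    filter_upwards [self_mem_nhdsWithin] with z hz
    have hz : z ≠ 0 := hz
    simp only [slope_def_field, sub_zero, hz, if_false, if_true]
    field_simp

/-- The kernels as functions of `q = √S`, the chord `s = 2 sin (z/2)` and `u = (1 - q) / s`. -/
lemma kernels_eq {α X z q u : ℝ} (hq : 0 < q) (hs : 2 * sin (z / 2) ≠ 0)
    (hS : Sq X z = q ^ 2) (hu : 2 * sin (z / 2) * u = 1 - q) :
    K1 α X z = -(2 - cos z / q) * (q + u ^ 2) ^ (-(α / 2)) +
        α * (sin (z / 2) - u) ^ 2 * (q + u ^ 2) ^ (-(α / 2) - 1) ∧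
      K2 α X z = q⁻¹ * (q + u ^ 2) ^ (-(α / 2)) ∧
      K3 α X z = (q ^ 3)⁻¹ * sin z * (q + u ^ 2) ^ (-(α / 2)) +
        α * (sin (z / 2) - u) * cos (z / 2) * (q ^ 2)⁻¹ * (q + u ^ 2) ^ (-(α / 2) - 1) := by
  have hN : 0 < q + u ^ 2 := by positivity
  have hcos : cos z = 1 - 2 * sin (z / 2) ^ 2 := by
    have := cos_two_mul (z / 2)
    have h2 := sin_sq_add_cos_sq (z / 2)
    rw [show 2 * (z / 2) = z by ring] at this
    linarith
  have hsin : sin z = 2 * sin (z / 2) * cos (z / 2) := by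
    rw [← sin_two_mul]; ring_nf
  have hsqrt : √(Sq X z) = q := by rw [hS, sqrt_sq hq.le]
  have hD : 2 * Dz X z = |2 * sin (z / 2)| ^ 2 * (q + u ^ 2) := by
    have h1 : 4 * X * sin (z / 2) = 1 - q ^ 2 := by rw [← hS, Sq]; ring
    rw [Dz, hsqrt, hcos, sq_abs, mul_add, ← mul_pow, hu]
    linear_combination -h1
  have habs : 0 < |2 * sin (z / 2)| := abs_pos.2 hs
  have hD1 : (2 * Dz X z) ^ (α / 2) = |2 * sin (z / 2)| ^ α * (q + u ^ 2) ^ (α / 2) := by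
    rw [hD, mul_rpow (by positivity) hN.le, ← rpow_natCast, ← rpow_mul habs.le]
    congr 2
    push_cast; ring
  have hD2 : (2 * Dz X z) ^ (α / 2 + 1) =
      |2 * sin (z / 2)| ^ α * (2 * sin (z / 2)) ^ 2 * ((q + u ^ 2) ^ (α / 2) * (q + u ^ 2)) := by
    rw [rpow_add_one (by rw [hD]; positivity), hD1, hD, sq_abs]
    ring
  have hS3 : (Sq X z) ^ (-(3 / 2) : ℝ) = (q ^ 3)⁻¹ := by
    rw [hS, ← rpow_natCast, ← rpow_mul hq.le, ← rpow_natCast q 3, ← rpow_neg hq.le]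
    congr 1; push_cast; ring
  have hS1 : (Sq X z) ^ (-(1 / 2) : ℝ) = q⁻¹ := by
    rw [hS, ← rpow_natCast, ← rpow_mul hq.le, ← rpow_neg_one]
    congr 1; push_cast; ring
  have hNa : (q + u ^ 2) ^ (-(α / 2)) = ((q + u ^ 2) ^ (α / 2))⁻¹ := rpow_neg hN.le _
  have hNb : (q + u ^ 2) ^ (-(α / 2) - 1) = ((q + u ^ 2) ^ (α / 2) * (q + u ^ 2))⁻¹ := by
    rw [rpow_sub_one hN.ne', hNa, mul_inv, div_eq_mul_inv]
  have hA : 0 < |2 * sin (z / 2)| ^ α := by positivity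
  have hB : 0 < (q + u ^ 2) ^ (α / 2) := by positivity
  have hqc : q - cos z = 2 * sin (z / 2) * (sin (z / 2) - u) := by
    rw [hcos]; linear_combination hu
  have hqc' : 1 - cos z / q = 2 * sin (z / 2) * (sin (z / 2) - u) / q := by
    rw [← hqc]; field_simp
  have hqc'' : q ^ 2 - q * cos z = q * (2 * sin (z / 2) * (sin (z / 2) - u)) := by
    rw [← hqc]; ring
  rw [K1, K2, K3, hD1, hD2, hsqrt, hS1, hS3, hNa, hNb, hS, hqc', hqc'']
  generalize |2 * sin (z / 2)| ^ α = A at *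
  generalize (q + u ^ 2) ^ (α / 2) = B at *
  generalize q + u ^ 2 = N at *
  have hs' : sin (z / 2) ≠ 0 := fun h => hs (by simp [h])
  rw [hsin]
  generalize cos z = c
  generalize cos (z / 2) = c'
  generalize sin (z / 2) = s at *
  refine ⟨?_, ?_, ?_⟩ <;> field_simp

open Filter Topology in
/-- A function continuous at `a` that agrees near `a`, off `a`, with one differentiable at `a`,
has the same value and derivative at `a`. -/
lemma value_and_deriv_of_eventuallyEq_punctured {φ G : ℝ → ℝ} {a d : ℝ} (hφ : ContinuousAt φ a)
    (hG : HasDerivAt G d a) (h : φ =ᶠ[𝓝[≠] a] G) : φ a = G a ∧ deriv φ a = d := by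
  have h' := (hφ.eventuallyEq_nhds_iff_eventuallyEq_nhdsNE hG.continuousAt).1 h
  exact ⟨h'.eq_of_nhds, by rw [h'.deriv_eq, hG.deriv]⟩

/-- First-order expansions at `0` of the regularised kernels, in terms of `p = r'/r` and
`w = r''/r`. -/
lemma hasDerivAt_regularised_kernels {α p w : ℝ} {q u : ℝ → ℝ} (hq0 : q 0 = 1) (hu0 : u 0 = p)
    (hq : HasDerivAt q (-p) 0) (hu : HasDerivAt u (-w / 2) 0) :
    HasDerivAt (fun z => -(2 - cos z / q z) * (q z + u z ^ 2) ^ (-(α / 2)) +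
        α * (sin (z / 2) - u z) ^ 2 * (q z + u z ^ 2) ^ (-(α / 2) - 1))
      (p * (1 + p ^ 2) ^ (-(α / 2)) - 3 * (α / 2) * (p * (1 + w)) * (1 + p ^ 2) ^ (-(α / 2) - 1)
        + α * (α / 2 + 1) * p ^ 2 * (p * (1 + w)) * (1 + p ^ 2) ^ (-(α / 2) - 2)) 0 ∧
    HasDerivAt (fun z => (q z)⁻¹ * (q z + u z ^ 2) ^ (-(α / 2)))
      (p * (1 + p ^ 2) ^ (-(α / 2)) + α / 2 * (p * (1 + w)) * (1 + p ^ 2) ^ (-(α / 2) - 1)) 0 ∧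
    HasDerivAt (fun z => (q z ^ 3)⁻¹ * sin z * (q z + u z ^ 2) ^ (-(α / 2)) +
        α * (sin (z / 2) - u z) * cos (z / 2) * (q z ^ 2)⁻¹ * (q z + u z ^ 2) ^ (-(α / 2) - 1))
      ((1 + p ^ 2) ^ (-(α / 2)) + α * ((1 + w) / 2 - 2 * p ^ 2) * (1 + p ^ 2) ^ (-(α / 2) - 1)
        - α * (α / 2 + 1) * p * (p * (1 + w)) * (1 + p ^ 2) ^ (-(α / 2) - 2)) 0 := by
  have hN := hq.add (hu.pow 2)
  have hN0 : q 0 + u 0 ^ 2 ≠ 0 := by rw [hq0]; positivity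
  have hpow (b : ℝ) : HasDerivAt (fun z => (q z + u z ^ 2) ^ b) _ 0 :=
    hN.rpow_const (p := b) (Or.inl hN0)
  have hsin : HasDerivAt (fun z : ℝ => sin (z / 2)) (1 / 2) 0 := by
    simpa using ((hasDerivAt_id (0 : ℝ)).div_const 2).sin
  have hcos : HasDerivAt (fun z : ℝ => cos (z / 2)) 0 0 := by
    simpa using ((hasDerivAt_id (0 : ℝ)).div_const 2).cos
  have hq1 : q 0 ≠ 0 := by simp [hq0]
  have e2 : -(α / 2) - 1 - 1 = -(α / 2) - 2 := by ring
  refine ⟨?_, ?_, ?_⟩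
  · have := ((((hasDerivAt_cos 0).div hq hq1).const_sub 2).neg.mul (hpow (-(α / 2)))).add
      ((((hsin.sub hu).pow 2).const_mul α).mul (hpow (-(α / 2) - 1)))
    refine this.congr_deriv ?_
    simp [hq0, hu0, e2]
    ring
  · refine ((hq.inv hq1).mul (hpow (-(α / 2)))).congr_deriv ?_
    simp [hq0, hu0]
    ring
  · have := ((((hq.pow 3).inv (pow_ne_zero 3 hq1)).mul (hasDerivAt_sin 0)).mul
      (hpow (-(α / 2)))).add
      (((((hsin.sub hu).const_mul α).mul hcos).mul ((hq.pow 2).inv (pow_ne_zero 2 hq1))).mul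
        (hpow (-(α / 2) - 1)))
    refine this.congr_deriv ?_
    simp [hq0, hu0, e2]
    ring

lemma two_sin_half_ne_zero {z : ℝ} (hz : 0 < |z|) (hzπ : |z| < π) : 2 * sin (z / 2) ≠ 0 := by
  rw [abs_lt] at hzπ
  have hz := abs_pos.1 hz
  refine mul_ne_zero two_ne_zero fun h => hz ?_
  have := (sin_eq_zero_iff_of_lt_of_lt (by linarith) (by linarith)).1 h
  linarith

/-- Existence of the regularised difference quotient of `z ↦ r (x - z) / r x`. -/
lemma exists_chord_quotient {r r' : ℝ → ℝ} {x w : ℝ} (hx : r x ≠ 0)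
    (hr : ∀ y, HasDerivAt r (r' y) y) (hr' : HasDerivAt r' w x) :
    ∃ u : ℝ → ℝ, (∀ z, 0 < |z| → |z| < π → 2 * sin (z / 2) * u z = 1 - r (x - z) / r x) ∧
      u 0 = r' x / r x ∧ HasDerivAt u (-(w / r x) / 2) 0 := by
  have hsub (z : ℝ) : HasDerivAt (fun z => x - z) (-1) z := by
    simpa using (hasDerivAt_id z).const_sub x
  obtain ⟨g, hg, hg0, hg'⟩ := exists_eq_id_mul_hasDerivAt
    (h := fun z => 1 - r (x - z) / r x) (h' := fun z => r' (x - z) / r x) (d := -(w / r x))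
    (fun z => by
      refine ((((hr (x - z)).comp z (hsub z)).div_const (r x)).const_sub 1).congr_deriv ?_
      ring)
    (by
      have h0 : HasDerivAt r' w (x - 0) := by simpa using hr'
      refine ((h0.comp (0 : ℝ) (hsub 0)).div_const (r x)).congr_deriv ?_
      ring)
    (by simp [hx])
  have hhalf (z : ℝ) : HasDerivAt (fun z : ℝ => z / 2) (1 / 2) z :=
    (hasDerivAt_id z).div_const 2
  obtain ⟨σ, hσ, hσ0, hσ'⟩ := exists_eq_id_mul_hasDerivAt
    (h := fun z => 2 * sin (z / 2)) (h' := fun z => cos (z / 2)) (d := 0)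
    (fun z => by
      refine ((hhalf z).sin.const_mul 2).congr_deriv ?_
      ring)
    (by simpa using (hhalf 0).cos) (by simp)
  have hσ1 : σ 0 = 1 := by simpa using hσ0
  refine ⟨fun z => g z / σ z, fun z hz hzπ => ?_, by simp [hσ1, hg0], ?_⟩
  · have hs : 2 * sin (z / 2) ≠ 0 := two_sin_half_ne_zero hz hzπ
    have hσz : σ z ≠ 0 := by
      intro h
      exact hs (by rw [hσ z, h, mul_zero])
    rw [hσ z, hg z]
    field_simp
  · refine (hg'.div hσ' (by simp [hσ1])).congr_deriv ?_
    simp [hσ1]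

open Filter Topology in
/-- Values and `z`-derivatives at `0` of continuous extensions of the kernels `K^j(X_f(x, z))`,
with `r = √(1 + 2f)`. -/
lemma kernel_coefficients {α : ℝ} {f r r' : ℝ → ℝ} {x w : ℝ} (hrpos : ∀ y, 0 < r y)
    (hr : ∀ y, HasDerivAt r (r' y) y) (hr' : HasDerivAt r' w x)
    (hm : ∀ y, 1 + 2 * f y = r y ^ 2) :
    (∀ φ : ℝ → ℝ, ContinuousAt φ 0 →
      (∀ z, 0 < |z| → |z| < π → φ z = K1 α (Xf f x z) z) →
      φ 0 = -(1 + (r' x / r x) ^ 2) ^ (-(α / 2)) +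
          α * (r' x / r x) ^ 2 * (1 + (r' x / r x) ^ 2) ^ (-(α / 2) - 1) ∧
      deriv φ 0 = r' x / r x * (1 + (r' x / r x) ^ 2) ^ (-(α / 2))
        - 3 * (α / 2) * (r' x / r x * (1 + w / r x)) * (1 + (r' x / r x) ^ 2) ^ (-(α / 2) - 1)
        + α * (α / 2 + 1) * (r' x / r x) ^ 2 * (r' x / r x * (1 + w / r x)) *
          (1 + (r' x / r x) ^ 2) ^ (-(α / 2) - 2)) ∧
    (∀ φ : ℝ → ℝ, ContinuousAt φ 0 →
      (∀ z, 0 < |z| → |z| < π → φ z = K2 α (Xf f x z) z) →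
      φ 0 = (1 + (r' x / r x) ^ 2) ^ (-(α / 2)) ∧
      deriv φ 0 = r' x / r x * (1 + (r' x / r x) ^ 2) ^ (-(α / 2)) +
        α / 2 * (r' x / r x * (1 + w / r x)) * (1 + (r' x / r x) ^ 2) ^ (-(α / 2) - 1)) ∧
    (∀ φ : ℝ → ℝ, ContinuousAt φ 0 →
      (∀ z, 0 < |z| → |z| < π → φ z = K3 α (Xf f x z) z) →
      φ 0 = -(α * (r' x / r x) * (1 + (r' x / r x) ^ 2) ^ (-(α / 2) - 1)) ∧
      deriv φ 0 = (1 + (r' x / r x) ^ 2) ^ (-(α / 2))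
        + α * ((1 + w / r x) / 2 - 2 * (r' x / r x) ^ 2) *
          (1 + (r' x / r x) ^ 2) ^ (-(α / 2) - 1)
        - α * (α / 2 + 1) * (r' x / r x) * (r' x / r x * (1 + w / r x)) *
          (1 + (r' x / r x) ^ 2) ^ (-(α / 2) - 2)) := by
  have hx := (hrpos x).ne'
  obtain ⟨u, hu, hu0, hu'⟩ := exists_chord_quotient hx hr hr'
  have hq : HasDerivAt (fun z => r (x - z) / r x) (-(r' x / r x)) 0 := by
    have h0 : HasDerivAt r (r' x) (x - 0) := by simpa using hr x
    refine ((h0.comp (0 : ℝ) ((hasDerivAt_id (0 : ℝ)).const_sub x)).div_const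
      (r x)).congr_deriv ?_
    ring
  have hq0 : r (x - 0) / r x = 1 := by simp [hx]
  obtain ⟨h1, h2, h3⟩ := hasDerivAt_regularised_kernels (α := α) hq0 hu0 hq hu'
  have hS (z : ℝ) (hz : 0 < |z|) (hzπ : |z| < π) : Sq (Xf f x z) z = (r (x - z) / r x) ^ 2 := by
    have hs := two_sin_half_ne_zero hz hzπ
    have hs' : sin (z / 2) ≠ 0 := fun h => hs (by simp [h])
    rw [div_pow, Sq, Xf, deltaZ, hm, ← hm (x - z)]
    have := hm x
    field_simp
    linarith
  have hker (z : ℝ) (hz : 0 < |z|) (hzπ : |z| < π) :=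
    kernels_eq (α := α) (div_pos (hrpos (x - z)) (hrpos x)) (two_sin_half_ne_zero hz hzπ)
      (hS z hz hzπ) (hu z hz hzπ)
  have hev : ∀ᶠ z : ℝ in 𝓝[≠] 0, 0 < |z| ∧ |z| < π := by
    filter_upwards [self_mem_nhdsWithin,
      mem_nhdsWithin_of_mem_nhds (Metric.ball_mem_nhds (0 : ℝ) pi_pos)] with z hz hzπ
    exact ⟨abs_pos.2 hz, by simpa using hzπ⟩
  refine ⟨fun φ hφ hE => ?_, fun φ hφ hE => ?_, fun φ hφ hE => ?_⟩
  · obtain ⟨hv, hd⟩ := value_and_deriv_of_eventuallyEq_punctured hφ h1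
      (by filter_upwards [hev] with z hz using (hE z hz.1 hz.2).trans (hker z hz.1 hz.2).1)
    refine ⟨hv.trans ?_, hd⟩
    simp only [hu0, hq0, cos_zero, zero_div, sin_zero]
    ring
  · obtain ⟨hv, hd⟩ := value_and_deriv_of_eventuallyEq_punctured hφ h2
      (by filter_upwards [hev] with z hz using (hE z hz.1 hz.2).trans (hker z hz.1 hz.2).2.1)
    refine ⟨hv.trans ?_, hd⟩
    simp only [hu0, hq0]
    ring
  · obtain ⟨hv, hd⟩ := value_and_deriv_of_eventuallyEq_punctured hφ h3
      (by filter_upwards [hev] with z hz using (hE z hz.1 hz.2).trans (hker z hz.1 hz.2).2.2)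
    refine ⟨hv.trans ?_, hd⟩
    simp only [hu0, hq0, cos_zero, zero_div, sin_zero]
    ring

/-- Hamiltonian cancellation identity (equation (5.42), verified in Appendix A):
with `K^{j,0}(x) := Φ_j(x,0)`, `K^{j,1}(x) := ∂_zΦ_j(x,0)`, where the `Φ_j` are smooth
extensions of `z ↦ K^j_{α,z}(X_f(x,z))`, one has `A₁(x) + (1/2)·A₀'(x) = 0` for all `x`. -/
theorem hamiltonian_cancellation (α : ℝ) (hα : α ∈ Set.Ioo (0 : ℝ) 2)
    (f : ℝ → ℝ) (hf : ContDiff ℝ (⊤ : ℕ∞) f) (hper : ∀ x, f (x + 2 * π) = f x)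
    (hpos : ∀ x, 0 < 1 + 2 * f x)
    (hdom : ∀ x z : ℝ, 0 < |z| → |z| < π →
      0 < Sq (Xf f x z) z ∧ 0 < Dz (Xf f x z) z)
    (Φ₁ Φ₂ Φ₃ : ℝ → ℝ → ℝ)
    (hΦ₁ : ContDiffOn ℝ (⊤ : ℕ∞) (fun p : ℝ × ℝ => Φ₁ p.1 p.2) (Set.univ ×ˢ Set.Ioo (-π) π))
    (hΦ₂ : ContDiffOn ℝ (⊤ : ℕ∞) (fun p : ℝ × ℝ => Φ₂ p.1 p.2) (Set.univ ×ˢ Set.Ioo (-π) π))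
    (hΦ₃ : ContDiffOn ℝ (⊤ : ℕ∞) (fun p : ℝ × ℝ => Φ₃ p.1 p.2) (Set.univ ×ˢ Set.Ioo (-π) π))
    (hE₁ : ∀ x z : ℝ, 0 < |z| → |z| < π → Φ₁ x z = K1 α (Xf f x z) z)
    (hE₂ : ∀ x z : ℝ, 0 < |z| → |z| < π → Φ₂ x z = K2 α (Xf f x z) z)
    (hE₃ : ∀ x z : ℝ, 0 < |z| → |z| < π → Φ₃ x z = K3 α (Xf f x z) z) :
    ∀ x : ℝ,
      (1 + 2 * f x) ^ (-(α / 2)) *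
          (deriv (Φ₁ x) 0 + (α - 2) * deriv (Φ₂ x) 0 +
            (1 / (1 + 2 * f x)) *
              (deriv f x * deriv (Φ₃ x) 0 - deriv (deriv f) x * Φ₃ x 0))
        + (1 / 2) * deriv (fun y : ℝ =>
            (1 + 2 * f y) ^ (-(α / 2)) *
                (Φ₁ y 0 + (α - 1) * Φ₂ y 0 + (deriv f y / (1 + 2 * f y)) * Φ₃ y 0)
              + (2 - α)) x
      = 0 := by
  have hfd : Differentiable ℝ f := hf.differentiable (by simp)
  have hr : ContDiff ℝ (⊤ : ℕ∞) (fun y => √(1 + 2 * f y)) :=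
    (contDiff_const.add (contDiff_const.mul hf)).sqrt fun y => (hpos y).ne'
  obtain ⟨r, hr_def⟩ : ∃ r : ℝ → ℝ, r = fun y => √(1 + 2 * f y) := ⟨_, rfl⟩
  rw [← hr_def] at hr
  have hrpos (y : ℝ) : 0 < r y := by rw [hr_def]; exact sqrt_pos.2 (hpos y)
  have hm (y : ℝ) : 1 + 2 * f y = r y ^ 2 := by
    rw [hr_def]; exact (sq_sqrt (hpos y).le).symm
  have hr1 (y : ℝ) : HasDerivAt r (deriv r y) y :=
    (hr.differentiable (by simp) y).hasDerivAt
  have hr2 (y : ℝ) : HasDerivAt (deriv r) (deriv (deriv r) y) y :=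
    (((contDiff_infty_iff_deriv.1 hr).2).differentiable (by simp) y).hasDerivAt
  have hf1 : deriv f = fun y => r y * deriv r y := by
    funext y
    have h1 := ((hfd y).hasDerivAt.const_mul 2).const_add 1
    have h2 := (hr1 y).pow 2
    have h3 := h1.unique (h2.congr_of_eventuallyEq (Filter.Eventually.of_forall hm))
    norm_num at h3
    linarith
  have hf2 (y : ℝ) : deriv (deriv f) y = deriv r y ^ 2 + r y * deriv (deriv r) y := by
    refine (congrArg (deriv · y) hf1).trans (((hr1 y).mul (hr2 y)).deriv.trans ?_)
    ring
  have hval (y : ℝ) := kernel_coefficients (α := α) hrpos hr1 (hr2 y) hm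
  have hslice {Φ : ℝ → ℝ → ℝ}
      (hΦ : ContDiffOn ℝ (⊤ : ℕ∞) (fun p : ℝ × ℝ => Φ p.1 p.2)
        (Set.univ ×ˢ Set.Ioo (-π) π)) (y : ℝ) : ContinuousAt (Φ y) 0 := by
    have h1 : ContinuousAt (fun p : ℝ × ℝ => Φ p.1 p.2) (y, 0) :=
      hΦ.continuousOn.continuousAt
        ((isOpen_univ.prod isOpen_Ioo).mem_nhds ⟨trivial, by simp [pi_pos], pi_pos⟩)
    exact h1.comp (f := fun z : ℝ => (y, z)) (by fun_prop)
  have hv₁ (y : ℝ) := (hval y).1 (Φ₁ y) (hslice hΦ₁ y) (hE₁ y)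
  have hv₂ (y : ℝ) := (hval y).2.1 (Φ₂ y) (hslice hΦ₂ y) (hE₂ y)
  have hv₃ (y : ℝ) := (hval y).2.2 (Φ₃ y) (hslice hΦ₃ y) (hE₃ y)
  have hA₀ : (fun y : ℝ => (1 + 2 * f y) ^ (-(α / 2)) *
        (Φ₁ y 0 + (α - 1) * Φ₂ y 0 + (deriv f y / (1 + 2 * f y)) * Φ₃ y 0) + (2 - α)) =
      fun y => (α - 2) * (r y ^ 2 + deriv r y ^ 2) ^ (-(α / 2)) + (2 - α) := by
    funext y
    have hry := (hrpos y).ne'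
    have hsplit : r y ^ 2 + deriv r y ^ 2 = r y ^ 2 * (1 + (deriv r y / r y) ^ 2) := by
      field_simp
    rw [(hv₁ y).1, (hv₂ y).1, (hv₃ y).1, hsplit, mul_rpow (by positivity) (by positivity), hm, hf1]
    field_simp
    ring
  intro x
  have hrx := hrpos x
  have hderiv := ((((((hr1 x).pow 2).add ((hr2 x).pow 2)).rpow_const (p := -(α / 2))
    (Or.inl (by have := hrpos x; simp; positivity))).const_mul (α - 2)).add_const (2 - α)).deriv
  have hpow2 : r x ^ 2 + deriv r x ^ 2 = r x ^ 2 * (1 + (deriv r x / r x) ^ 2) := by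
    field_simp
  have hN : 0 < 1 + (deriv r x / r x) ^ 2 := by positivity
  rw [hA₀]
  simp only [Pi.add_apply, Pi.pow_apply] at hderiv
  refine (congrArg (fun t => _ + 1 / 2 * t) hderiv).trans ?_
  rw [(hv₁ x).2, (hv₂ x).2, (hv₃ x).2, (hv₃ x).1, hf2, hf1, hpow2,
    mul_rpow (by positivity) hN.le, rpow_sub_one (pow_ne_zero 2 hrx.ne'), hm,
    show -(α / 2) - 1 = -(α / 2) - 2 + 1 by ring,
    show (1 + (deriv r x / r x) ^ 2) ^ (-(α / 2)) =
      (1 + (deriv r x / r x) ^ 2) ^ (-(α / 2) - 2 + 1 + 1) by ring_nf,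
    rpow_add_one hN.ne', rpow_add_one hN.ne']
  generalize (1 + (deriv r x / r x) ^ 2) ^ (-(α / 2) - 2) = P
  generalize (r x ^ 2) ^ (-(α / 2)) = M
  push_cast
  field_simp
  ring
end
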